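/- arXiv:2104.03810 — 3 statements merged into one kernel-verified Lean document; each statement's English description precedes it below -/
import Mathlib

section
/- A random element Y = (Y_i)_{i∈ℤ^d} of ℝ₀^{ℤ^d} satisfies the tail-process identity (E[h(θ_k Y) 1{|Y_k| > 1}] = E[h(Y) 1{|Y_{−k}| > 1}] for every measurable h : ℝ^{ℤ^d} → [0,∞) and every k ∈ ℤ^d) if and only if the Mecke-type equation E[Σ_{k∈e(Y)} g(−k, θ_k Y)] = E[Σ_{k∈e(Y)} g(k, Y)] holds for every measurable g : ℤ^d × ℝ^{ℤ^d} → [0,∞). -/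
open MeasureTheory ENNReal Filter ProbabilityTheory

noncomputable section

/-- The space `ℝ^{ℤ^d}` of real-valued fields indexed by `ℤ^d`. -/
abbrev RField (d : ℕ) := (Fin d → ℤ) → ℝ

variable {d : ℕ}

/-- Shift operator: `shift k x = (x_{i+k})_i`, i.e. it moves the origin to `k`. -/
def shift (k : Fin d → ℤ) (x : RField d) : RField d := fun i => x (i + k)

/-- The set of exceedance-points of `x`. -/
def excSet (x : RField d) : Set (Fin d → ℤ) := {k | 1 < |x k|}

open Classical in
/-- Indicator (with values in `ℝ≥0∞`) of the event that `|x k| > s`. -/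
def exIndGT (s : ℝ) (k : Fin d → ℤ) (x : RField d) : ℝ≥0∞ := if s < |x k| then 1 else 0

/-- The tail-process identity:
`E[h(θ_k Y) 1{|Y_k| > 1}] = E[h(Y) 1{|Y_{−k}| > 1}]` for every measurable nonnegative `h`
and every `k ∈ ℤ^d`. -/
def TailIdentity {Ω : Type*} [MeasurableSpace Ω] (μ : Measure Ω) (Y : Ω → RField d) : Prop :=
  ∀ h : RField d → ℝ≥0∞, Measurable h → ∀ k : Fin d → ℤ,
    ∫⁻ ω, h (shift k (Y ω)) * exIndGT 1 k (Y ω) ∂μ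
      = ∫⁻ ω, h (Y ω) * exIndGT 1 (-k) (Y ω) ∂μ

/-- `Y` is exceedance-stationary: for every exceedance-map `τ` which is bijective on a
measurable set `B` (invariant under shifting the origin to exceedance-points, contained in
`ℝ₀^{ℤ^d}`) carrying the law of `Y`, we have `θ_τ Y ≐ Y`. -/
def ExcStationary {Ω : Type*} [MeasurableSpace Ω] (μ : Measure Ω) (Y : Ω → RField d) : Prop :=
  ∀ (B : Set (RField d)) (τ : RField d → Fin d → ℤ),
    MeasurableSet B → Measurable τ →
    (∀ x ∈ B, 1 < |x 0|) →
    (∀ x ∈ B, ∀ k ∈ excSet x, shift k x ∈ B) →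
    (∀ x ∈ B, τ x ∈ excSet x) →
    (∀ x ∈ B, Set.BijOn (fun k => k + τ (shift k x)) (excSet x) (excSet x)) →
    (∀ᵐ ω ∂μ, Y ω ∈ B) →
    Measure.map (fun ω => shift (τ (Y ω)) (Y ω)) μ = Measure.map Y μ

/-- `E₀`: elements of `ℝ₀^{ℤ^d}` with finitely many exceedance-points. -/
def E0set (d : ℕ) : Set (RField d) := {x | 1 < |x 0| ∧ (excSet x).Finite}

/-- `E`: elements of `ℝ^{ℤ^d}` with at least one but finitely many exceedance-points. -/
def Eset (d : ℕ) : Set (RField d) := {x | (excSet x).Nonempty ∧ (excSet x).Finite}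

/-- `l₀`: fields vanishing at infinity. -/
def l0set (d : ℕ) : Set (RField d) := {x | Tendsto (fun i => |x i|) cofinite (nhds 0)}

/-- Uniform norm `‖x‖ = sup_i |x_i|`. -/
def supNorm (x : RField d) : ℝ := ⨆ i, |x i|

/-- `V` is Pareto(α)-distributed: `P(V > y) = y^{-α}` for `y ≥ 1`. -/
def IsPareto {Ω : Type*} [MeasurableSpace Ω] (μ : Measure Ω) (V : Ω → ℝ) (α : ℝ) : Prop :=
  ∀ y : ℝ, 1 ≤ y → μ {ω | y < V ω} = ENNReal.ofReal (y ^ (-α))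

/-- An anchoring function on `S`: a measurable shift-covariant exceedance-map. -/
def IsAnchoringOn (S : Set (RField d)) (A : RField d → Fin d → ℤ) : Prop :=
  Measurable A ∧ ∀ x ∈ S, A x ∈ excSet x ∧ ∀ k ∈ excSet x, A (shift k x) + k = A x

/-- `h` is shift-invariant on `S`. -/
def ShiftInvariantOn (S : Set (RField d)) (h : RField d → ℝ≥0∞) : Prop :=
  ∀ x ∈ S, ∀ k : Fin d → ℤ, h (shift k x) = h x

lemma measurable_shift (k : Fin d → ℤ) : Measurable (shift k : RField d → RField d) :=
  measurable_pi_lambda _ fun i => measurable_pi_apply (i + k)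

lemma measurable_exIndGT (s : ℝ) (k : Fin d → ℤ) :
    Measurable (exIndGT s k : RField d → ℝ≥0∞) :=
  Measurable.ite (measurableSet_lt measurable_const (measurable_pi_apply k).abs)
    measurable_const measurable_const

/-- A random element `Y` of `ℝ₀^{ℤ^d}` satisfies the tail-process identity
if and only if the Mecke-type equation
`E[Σ_{k∈e(Y)} g(−k, θ_k Y)] = E[Σ_{k∈e(Y)} g(k, Y)]`
holds for every measurable `g : ℤ^d × ℝ^{ℤ^d} → [0,∞)`. -/
theorem tailIdentity_iff_mecke
    {Ω : Type*} [MeasurableSpace Ω] (μ : Measure Ω) [IsProbabilityMeasure μ]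
    (Y : Ω → RField d) (hY : Measurable Y) (hY0 : ∀ᵐ ω ∂μ, 1 < |Y ω 0|) :
    TailIdentity μ Y ↔
      ∀ g : (Fin d → ℤ) × RField d → ℝ≥0∞, Measurable g →
        ∫⁻ ω, ∑' k : Fin d → ℤ, exIndGT 1 k (Y ω) * g (-k, shift k (Y ω)) ∂μ
          = ∫⁻ ω, ∑' k : Fin d → ℤ, exIndGT 1 k (Y ω) * g (k, Y ω) ∂μ := by
  constructor
  · intro hT g hg
    have hind (k : Fin d → ℤ) : Measurable fun ω => exIndGT 1 k (Y ω) :=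
      (measurable_exIndGT 1 k).comp hY
    have hsec (k : Fin d → ℤ) : Measurable fun x : RField d => g (k, x) :=
      hg.comp measurable_prodMk_left
    have hshift (k : Fin d → ℤ) : Measurable fun ω => g (-k, shift k (Y ω)) :=
      (hsec (-k)).comp ((measurable_shift k).comp hY)
    have hfix (k : Fin d → ℤ) : Measurable fun ω => g (k, Y ω) := (hsec k).comp hY
    rw [lintegral_tsum fun k => ((hind k).fun_mul (hshift k)).aemeasurable,
      lintegral_tsum fun k => ((hind k).fun_mul (hfix k)).aemeasurable,
      ← (Equiv.neg (Fin d → ℤ)).tsum_eq fun k => ∫⁻ ω, exIndGT 1 k (Y ω) * g (k, Y ω) ∂μ]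
    refine tsum_congr fun k => ?_
    simpa only [mul_comm, Equiv.neg_apply] using hT (fun x => g (-k, x)) (hsec (-k)) k
  · intro hM h hh k
    classical
    have hg : Measurable fun p : (Fin d → ℤ) × RField d => if p.1 = -k then h p.2 else 0 :=
      Measurable.ite (measurable_fst (measurableSet_singleton (-k)))
        (hh.comp measurable_snd) measurable_const
    have key := hM _ hg
    simp only [neg_inj, mul_ite, mul_zero] at key
    have hleft (ω : Ω) : ∑' j : Fin d → ℤ,
        (if j = k then exIndGT 1 j (Y ω) * h (shift j (Y ω)) else 0)
          = h (shift k (Y ω)) * exIndGT 1 k (Y ω) := by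
      rw [tsum_eq_single k fun j hj => if_neg hj, if_pos rfl, mul_comm]
    have hright (ω : Ω) : ∑' j : Fin d → ℤ,
        (if j = -k then exIndGT 1 j (Y ω) * h (Y ω) else 0)
          = h (Y ω) * exIndGT 1 (-k) (Y ω) := by
      rw [tsum_eq_single (-k) fun j hj => if_neg hj, if_pos rfl, mul_comm]
    simpa only [hleft, hright] using key
end
end

section
/- Let Y be a random element of ℝ₀^{ℤ^d} satisfying the tail-process identity with P(Y ∈ E₀) = 1, and let A, A' be two anchoring functions with P(A(Y) = 0) > 0 and P(A'(Y) = 0) > 0; let Z^A and Z^{A'} be the corresponding anchored processes, with laws P(Y ∈ · | A(Y) = 0) and P(Y ∈ · | A'(Y) = 0). Then θ_{A'(Z^A)} Z^A has the same distribution as Z^{A'}; that is, anchored processes with respect to different anchoring functions are randomly shifted versions of one another. -/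
open MeasureTheory ENNReal Filter ProbabilityTheory

noncomputable section

variable {d : ℕ}

lemma measurable_shift_comp {τ : RField d → Fin d → ℤ} (hτ : Measurable τ) :
    Measurable fun x : RField d => shift (τ x) x := by
  have h : Measurable fun p : RField d × (Fin d → ℤ) => shift p.2 p.1 :=
    measurable_from_prod_countable_left fun k => measurable_shift k
  exact h.comp (measurable_id.prodMk hτ)

lemma measurableSet_mem_excSet (k : Fin d → ℤ) :
    MeasurableSet {x : RField d | k ∈ excSet x} :=
  measurableSet_lt measurable_const (measurable_pi_apply k).abs

/-- The tail-process identity for indicator functions. -/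
lemma TailIdentity.measure_eq {Ω : Type*} [MeasurableSpace Ω] {μ : Measure Ω}
    {Y : Ω → RField d} (hTI : TailIdentity μ Y) (hY : Measurable Y) {H : Set (RField d)}
    (hH : MeasurableSet H) (k : Fin d → ℤ) :
    μ {ω | shift k (Y ω) ∈ H ∧ k ∈ excSet (Y ω)} = μ {ω | Y ω ∈ H ∧ -k ∈ excSet (Y ω)} := by
  have h := hTI (H.indicator 1) (measurable_one.indicator hH) k
  have hl : ∀ ω, H.indicator (1 : RField d → ℝ≥0∞) (shift k (Y ω)) * exIndGT 1 k (Y ω)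
      = {ω | shift k (Y ω) ∈ H ∧ k ∈ excSet (Y ω)}.indicator 1 ω := by
    intro ω
    by_cases h1 : shift k (Y ω) ∈ H <;> by_cases h2 : 1 < |Y ω k| <;>
      simp [exIndGT, excSet, h1, h2]
  have hr : ∀ ω, H.indicator (1 : RField d → ℝ≥0∞) (Y ω) * exIndGT 1 (-k) (Y ω)
      = {ω | Y ω ∈ H ∧ -k ∈ excSet (Y ω)}.indicator 1 ω := by
    intro ω
    by_cases h1 : Y ω ∈ H <;> by_cases h2 : 1 < |Y ω (-k)| <;>
      simp [exIndGT, excSet, h1, h2]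
  simp only [hl, hr] at h
  rwa [lintegral_indicator_one, lintegral_indicator_one] at h
  · exact (hY hH).inter (hY (measurableSet_mem_excSet (-k)))
  · exact (((measurable_shift k).comp hY) hH).inter (hY (measurableSet_mem_excSet k))

lemma measure_eq_tsum_inter_fiber {α ι : Type*} [MeasurableSpace α] [MeasurableSpace ι]
    [Countable ι] [MeasurableSingletonClass ι] (μ : Measure α) {F : α → ι} (hF : Measurable F)
    {S : Set α} (hS : MeasurableSet S) : μ S = ∑' k, μ (S ∩ F ⁻¹' {k}) := by
  rw [← measure_iUnion]
  · rw [← Set.inter_iUnion, ← Set.preimage_iUnion, Set.iUnion_of_singleton, Set.preimage_univ,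
      Set.inter_univ]
  · intro i j hij
    refine Set.disjoint_left.2 ?_
    rintro x ⟨-, hi⟩ ⟨-, hj⟩
    exact hij (hi.symm.trans hj)
  · exact fun k => hS.inter (hF (measurableSet_singleton k))

/-- Shifting the origin to the anchor `A'` carries the law of `Y` restricted to `A = 0` to its
restriction to `A' = 0`. -/
lemma TailIdentity.map_restrict_anchor {Ω : Type*} [MeasurableSpace Ω] {μ : Measure Ω}
    {Y : Ω → RField d} (hTI : TailIdentity μ Y) (hY : Measurable Y)
    (hE0 : ∀ᵐ ω ∂μ, Y ω ∈ E0set d) {A A' : RField d → Fin d → ℤ}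
    (hA : IsAnchoringOn (E0set d) A) (hA' : IsAnchoringOn (E0set d) A') :
    ((Measure.map Y μ).restrict {x | A x = 0}).map (fun x => shift (A' x) x)
      = (Measure.map Y μ).restrict {x | A' x = 0} := by
  have hm (k : Fin d → ℤ) : MeasurableSet {x | A x = k} := hA.1 (measurableSet_singleton k)
  have hm' (k : Fin d → ℤ) : MeasurableSet {x | A' x = k} := hA'.1 (measurableSet_singleton k)
  ext B hB
  have hT := measurable_shift_comp hA'.1
  rw [Measure.map_apply hT hB, Measure.restrict_apply (hT hB), Measure.restrict_apply hB,
    Measure.map_apply hY ((hT hB).inter (hm 0)), Measure.map_apply hY (hB.inter (hm' 0)),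
    measure_eq_tsum_inter_fiber μ (hA'.1.comp hY) (hY ((hT hB).inter (hm 0))),
    measure_eq_tsum_inter_fiber μ (hA.1.comp hY) (hY (hB.inter (hm' 0))),
    ← (Equiv.neg (Fin d → ℤ)).tsum_eq fun k => μ (_ ∩ (A ∘ Y) ⁻¹' {k})]
  refine tsum_congr fun k => ?_
  have key := hTI.measure_eq hY ((hB.inter (hm' 0)).inter (hm (-k))) k
  refine Eq.trans (measure_congr ?_) (key.trans (measure_congr ?_))
  · filter_upwards [hE0] with ω hω
    obtain ⟨-, hcov⟩ := hA.2 _ hω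
    obtain ⟨hexc', hcov'⟩ := hA'.2 _ hω
    refine propext ⟨?_, ?_⟩
    · rintro ⟨⟨hb, h0⟩, hk⟩
      change A (Y ω) = 0 at h0
      change A' (Y ω) = k at hk
      change shift (A' (Y ω)) (Y ω) ∈ B at hb
      rw [hk] at hexc' hb
      have h1 := hcov k hexc'
      have h2 := hcov' k hexc'
      rw [h0] at h1
      rw [hk] at h2
      exact ⟨⟨⟨hb, add_eq_right.1 h2⟩, eq_neg_of_add_eq_zero_left h1⟩, hexc'⟩
    · rintro ⟨⟨⟨hb, h0⟩, hk⟩, hexc⟩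
      change A' (shift k (Y ω)) = 0 at h0
      change A (shift k (Y ω)) = -k at hk
      have h1 := hcov k hexc
      have h2 := hcov' k hexc
      rw [hk, neg_add_cancel] at h1
      rw [h0, zero_add] at h2
      refine ⟨⟨?_, h1.symm⟩, h2.symm⟩
      change shift (A' (Y ω)) (Y ω) ∈ B
      rwa [← h2]
  · filter_upwards [hE0] with ω hω
    refine propext ⟨fun h => h.1, fun h => ⟨h, ?_⟩⟩
    have hk : A (Y ω) = -k := h.2
    exact hk ▸ (hA.2 _ hω).1

/-- For any two anchoring functions `A, A'`, the anchored processes are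
randomly shifted versions of one another: `θ_{A'(Z^A)} Z^A ≐ Z^{A'}`. -/
theorem anchored_processes_shift_equivalent
    {Ω : Type*} [MeasurableSpace Ω] (μ : Measure Ω) [IsProbabilityMeasure μ]
    (Y : Ω → RField d) (hY : Measurable Y) (hTI : TailIdentity μ Y)
    (hE0 : ∀ᵐ ω ∂μ, Y ω ∈ E0set d)
    (A A' : RField d → Fin d → ℤ)
    (hA : IsAnchoringOn (E0set d) A) (hA' : IsAnchoringOn (E0set d) A')
    (hpos : 0 < μ {ω | A (Y ω) = 0}) (hpos' : 0 < μ {ω | A' (Y ω) = 0}) :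
    Measure.map (fun x => shift (A' x) x)
        (ProbabilityTheory.cond (Measure.map Y μ) {x | A x = 0})
      = ProbabilityTheory.cond (Measure.map Y μ) {x | A' x = 0} := by
  have hres := hTI.map_restrict_anchor hY hE0 hA hA'
  have hmass : Measure.map Y μ {x | A x = 0} = Measure.map Y μ {x | A' x = 0} := by
    have h := congrArg (fun ν => ν Set.univ) hres
    simpa [Measure.map_apply (measurable_shift_comp hA'.1)] using h
  rw [ProbabilityTheory.cond, ProbabilityTheory.cond, Measure.map_smul, hres, hmass]
end
end

section
/- Let Y be a random element of ℝ₀^{ℤ^d} satisfying the tail-process identity with P(Y ∈ E₀) = 1, A an anchoring function with ϑ_A := P(A(Y) = 0) > 0, and Z^A the anchored process with law P(Y ∈ · | A(Y) = 0). Then the distributions of θ_{A(Y)} Y and Z^A are equivalent: for every measurable set B ⊆ E₀, P(θ_{A(Y)} Y ∈ B) = 1 if and only if P(Z^A ∈ B) = 1. -/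
open MeasureTheory ENNReal Filter ProbabilityTheory

noncomputable section

variable {d : ℕ}

@[simp]
lemma shift_zero (x : RField d) : shift 0 x = x := by
  funext i
  simp [shift]

lemma measurable_shift_comp_s10 {Ω : Type*} [MeasurableSpace Ω] {κ : Ω → Fin d → ℤ}
    {Y : Ω → RField d} (hκ : Measurable κ) (hY : Measurable Y) :
    Measurable fun ω => shift (κ ω) (Y ω) := by
  have h : Measurable fun p : (Fin d → ℤ) × RField d => shift p.1 p.2 :=
    measurable_from_prod_countable_right measurable_shift
  exact h.comp (hκ.prodMk hY)

/-- If `Y` a.s. avoids `N`, then so do the shifts of `Y` to its exceedance-points. -/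
lemma TailIdentity.ae_shift_notMem {Ω : Type*} [MeasurableSpace Ω] {μ : Measure Ω}
    {Y : Ω → RField d} (hY : Measurable Y) (hTI : TailIdentity μ Y)
    {N : Set (RField d)} (hN : MeasurableSet N) (hYN : ∀ᵐ ω ∂μ, Y ω ∉ N) :
    ∀ᵐ ω ∂μ, ∀ k ∈ excSet (Y ω), shift k (Y ω) ∉ N := by
  refine ae_all_iff.2 fun k => ?_
  have hzero : ∫⁻ ω, N.indicator 1 (shift k (Y ω)) * exIndGT 1 k (Y ω) ∂μ = 0 := by
    rw [hTI _ (measurable_one.indicator hN) k]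
    refine (lintegral_congr_ae ?_).trans lintegral_zero
    filter_upwards [hYN] with ω hω
    simp [hω]
  have hmeas : Measurable fun ω =>
      N.indicator (1 : RField d → ℝ≥0∞) (shift k (Y ω)) * exIndGT 1 k (Y ω) := by
    refine ((measurable_one.indicator hN).comp ((measurable_shift k).comp hY)).mul ?_
    refine Measurable.ite ?_ measurable_const measurable_const
    exact measurableSet_lt measurable_const ((measurable_pi_apply k).comp hY).abs
  filter_upwards [(lintegral_eq_zero_iff hmeas).1 hzero] with ω hω hk hmem
  have hk' : 1 < |Y ω k| := hk
  simp [hmem, exIndGT, hk'] at hω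

/-- The distributions of `θ_{A(Y)} Y` and of the anchored process `Z^A`
are equivalent: for every measurable `B ⊆ E₀`, `P(θ_{A(Y)} Y ∈ B) = 1 ↔ P(Z^A ∈ B) = 1`. -/
theorem anchored_and_shifted_tail_equivalent_laws
    {Ω : Type*} [MeasurableSpace Ω] (μ : Measure Ω) [IsProbabilityMeasure μ]
    (Y : Ω → RField d) (hY : Measurable Y) (hTI : TailIdentity μ Y)
    (hE0 : ∀ᵐ ω ∂μ, Y ω ∈ E0set d)
    (A : RField d → Fin d → ℤ) (hA : IsAnchoringOn (E0set d) A)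
    (hpos : 0 < μ {ω | A (Y ω) = 0}) :
    ∀ B : Set (RField d), MeasurableSet B → B ⊆ E0set d →
      (μ {ω | shift (A (Y ω)) (Y ω) ∈ B} = 1
        ↔ ProbabilityTheory.cond (Measure.map Y μ) {x | A x = 0} B = 1) := by
  intro B hB _
  have hA0 : MeasurableSet {x | A x = 0} := hA.1 (measurableSet_singleton 0)
  have hmap : Measure.map Y μ {x | A x = 0} ≠ 0 := by
    rw [Measure.map_apply hY hA0]
    exact hpos.ne'
  have := Measure.isProbabilityMeasure_map (μ := μ) hY.aemeasurable
  have := cond_isProbabilityMeasure hmap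
  have hcond : (Measure.map Y μ)[|{x | A x = 0}] B = 1 ↔
      ∀ᵐ ω ∂μ, Y ω ∉ {x | A x = 0} ∩ Bᶜ := by
    rw [← prob_compl_eq_zero_iff hB, cond_apply hA0, mul_eq_zero,
      or_iff_right (ENNReal.inv_ne_zero.2 (measure_ne_top _ _)),
      Measure.map_apply hY (hA0.inter hB.compl), ← compl_mem_ae_iff]
    rfl
  have hshift : μ {ω | shift (A (Y ω)) (Y ω) ∈ B} = 1 ↔
      ∀ᵐ ω ∂μ, shift (A (Y ω)) (Y ω) ∈ B :=
    (mem_ae_iff_prob_eq_one (measurable_shift_comp_s10 (hA.1.comp hY) hY hB)).symm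
  rw [hcond, hshift]
  constructor
  · intro h
    filter_upwards [h] with ω hω hmem
    rw [show A (Y ω) = 0 from hmem.1, shift_zero] at hω
    exact hmem.2 hω
  · intro h
    filter_upwards [hE0, hTI.ae_shift_notMem hY (hA0.inter hB.compl) h] with ω hω hN
    obtain ⟨hexc, hcov⟩ := hA.2 _ hω
    by_contra hmem
    exact hN _ hexc ⟨by simpa using hcov _ hexc, hmem⟩
end
end
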